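/- arXiv:0910.0236 — 6 statements merged into one kernel-verified Lean document; each statement's English description precedes it below -/
import Mathlib

section
/- Under hypothesis (H_B), with σ²(x) = 2B(x)/f(x) and base point c ∈ (l,r), the speed measure density m(x) := (2/σ²(x)) · exp(∫_c^x 2b(z)/σ²(z) dz) satisfies m(x) = f(x)/B(c) for every x ∈ (l,r). In particular the normalized speed density equals the prescribed probability density f. -/
open MeasureTheory Set intervalIntegral

noncomputable section

/-- The open interval `(l, r)` of real numbers, with extended-real endpoints. -/
def ooInterval (l r : EReal) : Set ℝ := {x : ℝ | l < (x : EReal) ∧ (x : EReal) < r}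

theorem isOpen_ooInterval (l r : EReal) : IsOpen (ooInterval l r) :=
  (isOpen_lt continuous_const continuous_coe_real_ereal).inter
    (isOpen_lt continuous_coe_real_ereal continuous_const)

theorem uIcc_subset_ooInterval {l r : EReal} {x y : ℝ} (hx : x ∈ ooInterval l r)
    (hy : y ∈ ooInterval l r) : uIcc x y ⊆ ooInterval l r := by
  have : OrdConnected (ooInterval l r) := ⟨fun _ ha _ hb _ hz =>
    ⟨ha.1.trans_le (EReal.coe_le_coe_iff.2 hz.1), (EReal.coe_le_coe_iff.2 hz.2).trans_lt hb.2⟩⟩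
  exact this.uIcc_subset hx hy

/-- The integral of `g` over `s ∩ (-∞, x]` has derivative `g x` at points `x` of an open set `s`
on which `g` is continuous and integrable. -/
theorem hasDerivAt_setIntegral_inter_Iic {s : Set ℝ} {g : ℝ → ℝ} (hs : IsOpen s)
    (hg : ContinuousOn g s) (hint : IntegrableOn g s) {x : ℝ} (hx : x ∈ s) :
    HasDerivAt (fun t => ∫ y in s ∩ Iic t, g y) (g x) x := by
  have hG : Integrable (s.indicator g) := (integrable_indicator_iff hs.measurableSet).2 hint
  have heq : s.indicator g =ᶠ[nhds x] g :=
    Filter.eventuallyEq_of_mem (hs.mem_nhds hx) fun y hy => indicator_of_mem hy g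
  have hGx : ContinuousAt (s.indicator g) x :=
    (hg.continuousAt (hs.mem_nhds hx)).congr heq.symm
  have hd := (integral_hasDerivAt_right (a := x) hG.intervalIntegrable
    (hG.aestronglyMeasurable.stronglyMeasurableAtFilter) hGx).const_add
      (∫ y in Iic x, s.indicator g y)
  rw [heq.eq_of_nhds] at hd
  refine hd.congr_of_eventuallyEq (Filter.Eventually.of_forall fun t => ?_)
  have h := integral_Iic_sub_Iic (a := x) (b := t) hG.integrableOn hG.integrableOn
  simp only
  rw [← h, add_sub_cancel, setIntegral_indicator hs.measurableSet, inter_comm]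

/-- Under hypothesis `(H_B)` and with `σ²(x) = 2B(x)/f(x)` and base point
`c ∈ (l,r)`, the speed measure density `m(x) = (2/σ²(x)) exp(∫_c^x 2b/σ²)` equals
`f(x)/B(c)` on `(l,r)`: the normalized speed density is the prescribed density `f`. -/
theorem stmt2 (l r : EReal) (hlr : l < r) (b f : ℝ → ℝ)
    (hb_cont : ContinuousOn b (ooInterval l r))
    (hf_cont : ContinuousOn f (ooInterval l r))
    (hf_pos : ∀ x ∈ ooInterval l r, 0 < f x)
    (hf_bdd : ∃ M, ∀ x ∈ ooInterval l r, f x ≤ M)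
    (hf_prob : ∫ y in ooInterval l r, f y = 1)
    (hbf_int : ∀ x ∈ ooInterval l r,
      IntegrableOn (fun y => b y * f y) (ooInterval l r ∩ Iic x))
    (hbf_int' : IntegrableOn (fun y => b y * f y) (ooInterval l r))
    (B : ℝ → ℝ) (hB : ∀ x, B x = ∫ y in ooInterval l r ∩ Iic x, b y * f y)
    (hBpos : ∀ x ∈ ooInterval l r, 0 < B x)
    (hbf_zero : ∫ y in ooInterval l r, b y * f y = 0)
    (σ2 : ℝ → ℝ) (hσ2 : ∀ x ∈ ooInterval l r, σ2 x = 2 * B x / f x)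
    (c : ℝ) (hc : c ∈ ooInterval l r)
    (m : ℝ → ℝ)
    (hm : ∀ x ∈ ooInterval l r,
      m x = (2 / σ2 x) * Real.exp (∫ z in c..x, 2 * b z / σ2 z)) :
    ∀ x ∈ ooInterval l r, m x = f x / B c := by
  have hB' : ∀ z ∈ ooInterval l r, HasDerivAt B (b z * f z) z := by
    intro z hz
    rw [funext hB]
    exact hasDerivAt_setIntegral_inter_Iic (isOpen_ooInterval l r) (hb_cont.mul hf_cont) hbf_int' hz
  intro x hx
  have hsub := uIcc_subset_ooInterval hc hx
  have hdrift : EqOn (fun z => 2 * b z / σ2 z) (fun z => b z * f z / B z) (uIcc c x) := by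
    intro z hz
    have := (hBpos z (hsub hz)).ne'
    have := (hf_pos z (hsub hz)).ne'
    simp only [hσ2 z (hsub hz)]
    field_simp
  have hcont : ContinuousOn (fun z => b z * f z / B z) (uIcc c x) :=
    ((hb_cont.mul hf_cont).mono hsub).div
      (fun z hz => (hB' z (hsub hz)).continuousAt.continuousWithinAt)
      fun z hz => (hBpos z (hsub hz)).ne'
  have hlog : ∫ z in c..x, 2 * b z / σ2 z = Real.log (B x) - Real.log (B c) := by
    rw [integral_congr hdrift]
    exact integral_eq_sub_of_hasDerivAt
      (fun z hz => (hB' z (hsub hz)).log (hBpos z (hsub hz)).ne') hcont.intervalIntegrable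
  have hBx := (hBpos x hx).ne'
  have hBc := (hBpos c hc).ne'
  have hfx := (hf_pos x hx).ne'
  rw [hm x hx, hlog, Real.exp_sub, Real.exp_log (hBpos x hx), Real.exp_log (hBpos c hc), hσ2 x hx]
  field_simp
end
end

section
/- Assume hypothesis (H_B) with finite endpoints l, r ∈ ℝ, and assume moreover that M := sup_{y ∈ (l,r)} |b(y)| f(y) < ∞. Then the scale function p(x) = B(c) ∫_c^x dy/B(y) (c ∈ (l,r) fixed) satisfies p(x) → +∞ as x → r⁻ and p(x) → −∞ as x → l⁺. (Indeed 0 < B(y) ≤ M (y − l) and 0 < B(y) ≤ M (r − y), so ∫_c^x dy/B(y) diverges at both endpoints.) -/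
open MeasureTheory Set Filter Topology intervalIntegral

noncomputable section

/-- A function dominating `K / (r - y)` near `r` has divergent integral at `r`. -/
theorem tendsto_integral_nhdsLT_atTop_of_div_le {h : ℝ → ℝ} {c r K : ℝ} (hcr : c < r)
    (hK : 0 < K) (hcont : ContinuousOn h (Ico c r)) (hle : ∀ y ∈ Ico c r, K / (r - y) ≤ h y) :
    Tendsto (fun x => ∫ y in c..x, h y) (𝓝[<] r) atTop := by
  have hlog : Tendsto (fun x => K * Real.log (r - c) + K * -Real.log (r - x)) (𝓝[<] r) atTop := by
    refine tendsto_atTop_add_const_left _ _ (Tendsto.const_mul_atTop hK ?_)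
    refine tendsto_neg_atBot_atTop.comp (Real.tendsto_log_nhdsGT_zero.comp ?_)
    refine tendsto_nhdsWithin_iff.2 ⟨?_, ?_⟩
    · have : Tendsto (fun x => r - x) (𝓝 r) (𝓝 (r - r)) := tendsto_const_nhds.sub tendsto_id
      rw [sub_self] at this
      exact this.mono_left nhdsWithin_le_nhds
    · filter_upwards [self_mem_nhdsWithin] with x hx
      exact sub_pos.2 (mem_Iio.1 hx)
  refine tendsto_atTop_mono' _ ?_ hlog
  filter_upwards [Ioo_mem_nhdsLT hcr] with x hx
  have hsub : Icc c x ⊆ Ico c r := fun y hy => ⟨hy.1, hy.2.trans_lt hx.2⟩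
  have hint : IntervalIntegrable (fun y => K / (r - y)) volume c x := by
    refine ContinuousOn.intervalIntegrable_of_Icc hx.1.le ?_
    refine continuousOn_const.div (continuousOn_const.sub continuousOn_id) fun y hy => ?_
    exact (sub_pos.2 (hsub hy).2).ne'
  have hFTC : ∫ y in c..x, K / (r - y) = -K * Real.log (r - x) - -K * Real.log (r - c) := by
    refine integral_eq_sub_of_hasDerivAt (f := fun y => -K * Real.log (r - y)) ?_ hint
    intro y hy
    rw [uIcc_of_le hx.1.le] at hy
    have hy' : r - y ≠ 0 := (sub_pos.2 (hsub hy).2).ne'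
    refine ((((hasDerivAt_id y).const_sub r).log hy').const_mul (-K)).congr_deriv ?_
    simp only [id_eq]
    ring
  calc K * Real.log (r - c) + K * -Real.log (r - x)
      = ∫ y in c..x, K / (r - y) := by rw [hFTC]; ring
    _ ≤ ∫ y in c..x, h y :=
      integral_mono_on hx.1.le hint
        ((hcont.mono hsub).intervalIntegrable_of_Icc hx.1.le) fun y hy => hle y (hsub hy)

/-- A function dominating `K / (y - l)` near `l` has divergent integral at `l`. -/
theorem tendsto_integral_nhdsGT_atBot_of_div_le {h : ℝ → ℝ} {c l K : ℝ} (hlc : l < c)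
    (hK : 0 < K) (hcont : ContinuousOn h (Ioc l c)) (hle : ∀ y ∈ Ioc l c, K / (y - l) ≤ h y) :
    Tendsto (fun x => ∫ y in c..x, h y) (𝓝[>] l) atBot := by
  have hmem : ∀ y ∈ Ico (-c) (-l), -y ∈ Ioc l c := fun y hy =>
    ⟨by linarith [hy.2], by linarith [hy.1]⟩
  have key := tendsto_integral_nhdsLT_atTop_of_div_le (h := fun y => h (-y)) (neg_lt_neg hlc) hK
    (hcont.comp continuousOn_neg hmem) fun y hy => by
      simpa [sub_eq_add_neg, add_comm] using hle (-y) (hmem y hy)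
  refine (tendsto_neg_atTop_atBot.comp (key.comp tendsto_neg_nhdsGT)).congr fun x => ?_
  simp [integral_comp_neg, integral_symm x c]

/-- Under hypothesis `(H_B)` with finite endpoints `l, r ∈ ℝ`, if
`M = sup |b| f < ∞` on `(l,r)`, then the scale function `p(x) = B(c) ∫_c^x dy/B(y)` tends
to `+∞` as `x → r⁻` and to `-∞` as `x → l⁺`. -/
theorem stmt3 (l r : ℝ) (hlr : l < r) (b f : ℝ → ℝ)
    (hb_cont : ContinuousOn b (Ioo l r))
    (hf_cont : ContinuousOn f (Ioo l r))
    (hf_pos : ∀ x ∈ Ioo l r, 0 < f x)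
    (hf_bdd : ∃ M', ∀ x ∈ Ioo l r, f x ≤ M')
    (hf_prob : ∫ y in Ioo l r, f y = 1)
    (hbf_int : ∀ x ∈ Ioo l r, IntegrableOn (fun y => b y * f y) (Ioo l r ∩ Iic x))
    (hbf_int' : IntegrableOn (fun y => b y * f y) (Ioo l r))
    (B : ℝ → ℝ) (hB : ∀ x, B x = ∫ y in Ioo l r ∩ Iic x, b y * f y)
    (hBpos : ∀ x ∈ Ioo l r, 0 < B x)
    (hbf_zero : ∫ y in Ioo l r, b y * f y = 0)
    (M : ℝ) (hM : ∀ y ∈ Ioo l r, |b y| * f y ≤ M)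
    (c : ℝ) (hc : c ∈ Ioo l r)
    (p : ℝ → ℝ) (hp : ∀ x ∈ Ioo l r, p x = B c * ∫ y in c..x, 1 / B y) :
    Tendsto p (𝓝[<] r) atTop ∧ Tendsto p (𝓝[>] l) atBot := by
  have hprim : ∀ x ∈ Ioo l r, B x = ∫ y in l..x, b y * f y := fun x hx => by
    have hset : Ioo l r ∩ Iic x = Ioc l x := by
      ext y
      exact ⟨fun hy => ⟨hy.1.1, hy.2⟩, fun hy => ⟨⟨hy.1, hy.2.trans_lt hx.2⟩, hy.2⟩⟩
    rw [hB, hset, integral_of_le hx.1.le]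
  have hInt : IntervalIntegrable (fun y => b y * f y) volume l r :=
    (intervalIntegrable_iff_integrableOn_Ioo_of_le hlr.le).2 hbf_int'
  have hBcont : ContinuousOn B (Ioo l r) := by
    refine ((continuousOn_primitive_interval' hInt left_mem_uIcc).mono ?_).congr hprim
    rw [uIcc_of_le hlr.le]
    exact Ioo_subset_Icc_self
  have hnorm : ∀ y ∈ Ioo l r, ‖b y * f y‖ ≤ M := fun y hy => by
    rw [norm_mul, Real.norm_eq_abs, Real.norm_of_nonneg (hf_pos y hy).le]
    exact hM y hy
  have hleft : ∀ x ∈ Ioo l r, B x ≤ M * (x - l) := fun x hx => by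
    rw [hprim x hx, ← abs_of_pos (sub_pos.2 hx.1)]
    refine (Real.le_norm_self _).trans (norm_integral_le_of_norm_le_const fun y hy => ?_)
    rw [uIoc_of_le hx.1.le] at hy
    exact hnorm y ⟨hy.1, hy.2.trans_lt hx.2⟩
  have hright : ∀ x ∈ Ioo l r, B x ≤ M * (r - x) := fun x hx => by
    have hx' : x ∈ uIcc l r := by
      rw [uIcc_of_le hlr.le]
      exact Ioo_subset_Icc_self hx
    have hsum := integral_add_adjacent_intervals
      (hInt.mono_set (uIcc_subset_uIcc_left hx')) (hInt.mono_set (uIcc_subset_uIcc_right hx'))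
    have hzero : ∫ y in l..r, b y * f y = 0 := by
      rw [integral_of_le hlr.le, integral_Ioc_eq_integral_Ioo, hbf_zero]
    rw [hprim x hx, eq_neg_of_add_eq_zero_left (hsum.trans hzero),
      ← abs_of_pos (sub_pos.2 hx.2)]
    refine (neg_le_abs _).trans ((Real.norm_eq_abs _).ge.trans (norm_integral_le_of_norm_le_const_ae ?_))
    filter_upwards [Measure.ae_ne volume r] with y hyr hy
    rw [uIoc_of_le hx.2.le] at hy
    exact hnorm y ⟨hx.1.trans hy.1, hy.2.lt_of_ne hyr⟩
  have hMpos : 0 < M :=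
    pos_of_mul_pos_left ((hBpos c hc).trans_le (hleft c hc)) (sub_pos.2 hc.1).le
  have hcont : ContinuousOn (fun y => 1 / B y) (Ioo l r) :=
    continuousOn_const.div hBcont fun y hy => (hBpos y hy).ne'
  have hdom : ∀ y ∈ Ioo l r, ∀ d, B y ≤ M * d → 1 / M / d ≤ 1 / B y := fun y hy d hd => by
    rw [div_div]
    exact one_div_le_one_div_of_le (hBpos y hy) hd
  have hsubr : Ico c r ⊆ Ioo l r := fun y hy => ⟨hc.1.trans_le hy.1, hy.2⟩
  have hsubl : Ioc l c ⊆ Ioo l r := fun y hy => ⟨hy.1, hy.2.trans_lt hc.2⟩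
  constructor
  · refine ((tendsto_integral_nhdsLT_atTop_of_div_le hc.2 (one_div_pos.2 hMpos) (hcont.mono hsubr)
      fun y hy => hdom y (hsubr hy) _ (hright y (hsubr hy))).const_mul_atTop
      (hBpos c hc)).congr' ?_
    filter_upwards [Ioo_mem_nhdsLT hlr] with x hx using (hp x hx).symm
  · refine ((tendsto_integral_nhdsGT_atBot_of_div_le hc.1 (one_div_pos.2 hMpos) (hcont.mono hsubl)
      fun y hy => hdom y (hsubl hy) _ (hleft y (hsubl hy))).const_mul_atBot
      (hBpos c hc)).congr' ?_
    filter_upwards [Ioo_mem_nhdsGT hlr] with x hx using (hp x hx).symm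
end
end

section
/- Uniqueness of the diffusion coefficient: assume hypothesis (H_B) with finite left endpoint l ∈ ℝ, and fix c ∈ (l,r). Let σ̃ : (l,r) → (0,∞) be continuous with z ↦ b(z)/σ̃²(z) locally integrable, and suppose there is a constant C > 0 such that for all x ∈ (l,r), (2/σ̃²(x)) · exp(∫_c^x 2b(z)/σ̃²(z) dz) = C f(x) (the speed density is proportional to f), and suppose the scale function diverges at the left endpoint: ∫_l^c exp(−∫_c^y 2b(z)/σ̃²(z) dz) dy = +∞. Then C = 1/B(c) and σ̃²(x) = 2B(x)/f(x) for every x ∈ (l,r). -/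
open MeasureTheory Set intervalIntegral

noncomputable section

theorem ordConnected_ooInterval (l r : EReal) : (ooInterval l r).OrdConnected :=
  ⟨fun _ hx _ hy _ hz => ⟨hx.1.trans_le (EReal.coe_le_coe_iff.2 hz.1),
    (EReal.coe_le_coe_iff.2 hz.2).trans_lt hy.2⟩⟩

theorem ooInterval_inter_Iic {l : ℝ} {r : EReal} {x : ℝ} (hx : x ∈ ooInterval l r) :
    ooInterval l r ∩ Iic x = Ioc l x := by
  ext y
  constructor
  · rintro ⟨hy, hyx⟩
    exact ⟨EReal.coe_lt_coe_iff.1 hy.1, hyx⟩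
  · rintro ⟨hy, hyx⟩
    exact ⟨⟨EReal.coe_lt_coe_iff.2 hy, (EReal.coe_le_coe_iff.2 hyx).trans_lt hx.2⟩, hyx⟩

/-- The exponential of a primitive of a continuous function `h` solves `E' = h * E`. -/
theorem exp_integral_sub_one_eq {s : Set ℝ} (hs : IsOpen s) (hsc : s.OrdConnected)
    {h : ℝ → ℝ} (hh : ContinuousOn h s) {c x : ℝ} (hc : c ∈ s) (hx : x ∈ s) :
    Real.exp (∫ z in c..x, h z) - 1 =
      ∫ y in c..x, h y * Real.exp (∫ z in c..y, h z) := by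
  have hderiv : ∀ y ∈ s, HasDerivAt (fun y => Real.exp (∫ z in c..y, h z))
      (h y * Real.exp (∫ z in c..y, h z)) y := by
    intro y hy
    have hint : IntervalIntegrable h volume c y :=
      (hh.mono (hsc.uIcc_subset hc hy)).intervalIntegrable
    rw [mul_comm]
    exact (integral_hasDerivAt_right hint (hh.stronglyMeasurableAtFilter hs y hy)
      (hh.continuousAt (hs.mem_nhds hy))).exp
  have hsub : uIcc c x ⊆ s := hsc.uIcc_subset hc hx
  have hcont : ContinuousOn (fun y => h y * Real.exp (∫ z in c..y, h z)) (uIcc c x) :=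
    (hh.mono hsub).mul fun y hy => (hderiv y (hsub hy)).continuousAt.continuousWithinAt
  rw [integral_eq_sub_of_hasDerivAt (fun y hy => hderiv y (hsub hy)) hcont.intervalIntegrable]
  simp

/-- Uniqueness of the diffusion coefficient: under hypothesis `(H_B)` with
finite left endpoint `l`, if a positive continuous candidate `σ̃` has speed density
proportional to `f` (with constant `C`) and its scale function diverges at the left endpoint,
then `C = 1/B(c)` and `σ̃² = 2B/f` on `(l,r)`. -/
theorem stmt4 (l : ℝ) (r : EReal) (hlr : (l : EReal) < r) (b f : ℝ → ℝ)
    (hb_cont : ContinuousOn b (ooInterval l r))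
    (hf_cont : ContinuousOn f (ooInterval l r))
    (hf_pos : ∀ x ∈ ooInterval l r, 0 < f x)
    (hf_bdd : ∃ M, ∀ x ∈ ooInterval l r, f x ≤ M)
    (hf_prob : ∫ y in ooInterval l r, f y = 1)
    (hbf_int : ∀ x ∈ ooInterval l r,
      IntegrableOn (fun y => b y * f y) (ooInterval l r ∩ Iic x))
    (hbf_int' : IntegrableOn (fun y => b y * f y) (ooInterval l r))
    (B : ℝ → ℝ) (hB : ∀ x, B x = ∫ y in ooInterval l r ∩ Iic x, b y * f y)
    (hBpos : ∀ x ∈ ooInterval l r, 0 < B x)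
    (hbf_zero : ∫ y in ooInterval l r, b y * f y = 0)
    (c : ℝ) (hc : c ∈ ooInterval l r)
    (σt : ℝ → ℝ) (hσt_cont : ContinuousOn σt (ooInterval l r))
    (hσt_pos : ∀ x ∈ ooInterval l r, 0 < σt x)
    (hloc : ∀ x ∈ ooInterval l r,
      IntervalIntegrable (fun z => b z / σt z ^ 2) volume c x)
    (C : ℝ) (hC : 0 < C)
    (hspeed : ∀ x ∈ ooInterval l r,
      (2 / σt x ^ 2) * Real.exp (∫ z in c..x, 2 * b z / σt z ^ 2) = C * f x)
    (hdiverge : ∫⁻ y in Ioo l c,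
      ENNReal.ofReal (Real.exp (-∫ z in c..y, 2 * b z / σt z ^ 2)) = ⊤) :
    C = 1 / B c ∧ ∀ x ∈ ooInterval l r, σt x ^ 2 = 2 * B x / f x := by
  have hs := isOpen_ooInterval l r
  have hsc := ordConnected_ooInterval l r
  have hlc : l < c := EReal.coe_lt_coe_iff.1 hc.1
  have hBI : ∀ x ∈ ooInterval l r, B x = ∫ y in l..x, b y * f y := by
    intro x hx
    rw [hB, ooInterval_inter_Iic hx, integral_of_le (EReal.coe_lt_coe_iff.1 hx.1).le]
  have hint : ∀ x ∈ ooInterval l r, IntervalIntegrable (fun y => b y * f y) volume l x := by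
    intro x hx
    rw [intervalIntegrable_iff_integrableOn_Ioc_of_le (EReal.coe_lt_coe_iff.1 hx.1).le,
      ← ooInterval_inter_Iic hx]
    exact hbf_int x hx
  have hcont : ContinuousOn (fun z => 2 * b z / σt z ^ 2) (ooInterval l r) :=
    (continuousOn_const.mul hb_cont).div (hσt_cont.pow 2)
      fun x hx => (pow_pos (hσt_pos x hx) 2).ne'
  have hE : ∀ x ∈ ooInterval l r,
      Real.exp (∫ z in c..x, 2 * b z / σt z ^ 2) = 1 - C * B c + C * B x := by
    intro x hx
    have h1 := exp_integral_sub_one_eq hs hsc hcont hc hx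
    have h2 : ∫ y in c..x, (2 * b y / σt y ^ 2) * Real.exp (∫ z in c..y, 2 * b z / σt z ^ 2) =
        ∫ y in c..x, C * (b y * f y) := by
      refine integral_congr fun y hy => ?_
      have h3 := hspeed y (hsc.uIcc_subset hc hx hy)
      linear_combination b y * h3
    rw [h2, intervalIntegral.integral_const_mul, ← integral_interval_sub_left (hint x hx) (hint c hc),
      ← hBI x hx, ← hBI c hc] at h1
    linear_combination h1
  have hIoo : Ioo l c ⊆ ooInterval l r := fun y hy =>
    ⟨EReal.coe_lt_coe_iff.2 hy.1, (EReal.coe_lt_coe_iff.2 hy.2).trans hc.2⟩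
  have hBlim : Filter.Tendsto B (nhdsWithin l (Ioo l c)) (nhds 0) := by
    have h1 : ContinuousOn (fun x => ∫ y in l..x, b y * f y) (uIcc l c) :=
      continuousOn_primitive_interval (by
        rw [uIcc_of_le hlc.le, integrableOn_Icc_iff_integrableOn_Ioc,
          ← ooInterval_inter_Iic hc]
        exact hbf_int c hc)
    have h2 := (h1 l left_mem_uIcc).mono (Ioo_subset_Icc_self.trans Icc_subset_uIcc)
    rw [ContinuousWithinAt, integral_same] at h2
    exact h2.congr' (eventually_nhdsWithin_of_forall fun x hx => (hBI x (hIoo hx)).symm)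
  have hnonneg : 0 ≤ 1 - C * B c := by
    have : (nhdsWithin l (Ioo l c)).NeBot := left_nhdsWithin_Ioo_neBot hlc
    have h1 : Filter.Tendsto (fun x => 1 - C * B c + C * B x) (nhdsWithin l (Ioo l c))
        (nhds (1 - C * B c + C * 0)) := (hBlim.const_mul C).const_add _
    rw [mul_zero, add_zero] at h1
    exact ge_of_tendsto h1 (eventually_nhdsWithin_of_forall fun x hx =>
      hE x (hIoo hx) ▸ (Real.exp_pos _).le)
  have hzero : 1 - C * B c = 0 := by
    refine (hnonneg.eq_or_lt.resolve_right fun hpos => ?_).symm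
    refine absurd hdiverge (ne_top_of_le_ne_top (b := ∫⁻ _ in Ioo l c,
      ENNReal.ofReal (1 - C * B c)⁻¹) ?_ (setLIntegral_mono measurable_const fun y hy => ?_))
    · rw [setLIntegral_const, Real.volume_Ioo]
      exact ENNReal.mul_ne_top ENNReal.ofReal_ne_top ENNReal.ofReal_ne_top
    · rw [Real.exp_neg, hE y (hIoo hy)]
      exact ENNReal.ofReal_le_ofReal (inv_anti₀ hpos
        (le_add_of_nonneg_right (mul_pos hC (hBpos y (hIoo hy))).le))
  refine ⟨?_, fun x hx => ?_⟩
  · rw [eq_div_iff (hBpos c hc).ne']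
    linarith
  · have h1 := hspeed x hx
    have hσ := hσt_pos x hx
    rw [hE x hx, hzero, zero_add, div_mul_eq_mul_div, div_eq_iff (pow_pos hσ 2).ne'] at h1
    rw [eq_div_iff (hf_pos x hx).ne']
    refine mul_left_cancel₀ hC.ne' ?_
    linear_combination -h1
end
end

section
/- Quasi-saddlepoint stationary density: let b, t̂ : (l,r) → ℝ be continuous with b(x)·t̂(x) < 0 for every x ∈ (l,r), t̂ continuously differentiable, and κ : I → ℝ differentiable with κ'(t̂(y)) = y for all y ∈ (l,r). Define σ²(x) = −2 b(x)/t̂(x) (which is strictly positive). Then for any base point c ∈ (l,r), the speed density m(x) := (2/σ²(x)) · exp(∫_c^x 2b(z)/σ²(z) dz) satisfies, for all x ∈ (l,r), m(x) = e^{c·t̂(c) − κ(t̂(c))} · (2/σ²(x)) · e^{−(x·t̂(x) − κ(t̂(x)))}; i.e. the speed density is proportional to x ↦ σ(x)^{−2} e^{−(x t̂(x) − κ(t̂(x)))}, the quasi-saddlepoint density approximation. -/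
open MeasureTheory Set intervalIntegral

noncomputable section

/-- The Legendre-type exponent `y t̂(y) - κ(t̂(y))` has derivative `t̂(y)` at a saddlepoint. -/
theorem hasDerivAt_mul_sub_comp_of_saddlepoint {th κ : ℝ → ℝ} {y : ℝ}
    (hth : DifferentiableAt ℝ th y) (hκ : HasDerivAt κ y (th y)) :
    HasDerivAt (fun z => z * th z - κ (th z)) (th y) y := by
  refine (((hasDerivAt_id' y).mul hth.hasDerivAt).sub
    (hκ.comp y hth.hasDerivAt)).congr_deriv ?_
  ring

/-- Quasi-saddlepoint stationary density: if `b, t̂` are continuous on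
`(l,r)` with `b t̂ < 0`, `t̂` is `C¹`, and `κ'(t̂(y)) = y`, then with `σ²(x) = -2b(x)/t̂(x)`
(which is strictly positive), the speed density `m(x) = (2/σ²(x)) exp(∫_c^x 2b/σ²)` equals
`e^{c t̂(c) - κ(t̂(c))} (2/σ²(x)) e^{-(x t̂(x) - κ(t̂(x)))}` for all `x ∈ (l,r)`. -/
theorem stmt7 (I : Set ℝ) (hI_open : IsOpen I) (hI_conn : I.OrdConnected)
    (l r : EReal) (hlr : l < r)
    (b th : ℝ → ℝ)
    (hb_cont : ContinuousOn b (ooInterval l r))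
    (hth_cont : ContinuousOn th (ooInterval l r))
    (hbth : ∀ x ∈ ooInterval l r, b x * th x < 0)
    (hth : ContDiffOn ℝ 1 th (ooInterval l r))
    (κ κ' : ℝ → ℝ) (hκ : ∀ t ∈ I, HasDerivAt κ (κ' t) t)
    (hmap : ∀ y ∈ ooInterval l r, th y ∈ I)
    (hsaddle : ∀ y ∈ ooInterval l r, κ' (th y) = y)
    (σ2 : ℝ → ℝ) (hσ2 : ∀ x ∈ ooInterval l r, σ2 x = -2 * b x / th x)
    (c : ℝ) (hc : c ∈ ooInterval l r)
    (m : ℝ → ℝ)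
    (hm : ∀ x ∈ ooInterval l r,
      m x = (2 / σ2 x) * Real.exp (∫ z in c..x, 2 * b z / σ2 z)) :
    (∀ x ∈ ooInterval l r, 0 < σ2 x) ∧
      ∀ x ∈ ooInterval l r,
        m x = Real.exp (c * th c - κ (th c)) * (2 / σ2 x) *
          Real.exp (-(x * th x - κ (th x))) := by
  have hσ_pos : ∀ x ∈ ooInterval l r, 0 < σ2 x := fun x hx => by
    have hth0 : th x ≠ 0 := right_ne_zero_of_mul (hbth x hx).ne
    have hσ : σ2 x = -2 * (b x * th x) / th x ^ 2 := by
      rw [hσ2 x hx]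
      field_simp
    rw [hσ]
    exact div_pos (by linarith [hbth x hx]) (by positivity)
  refine ⟨hσ_pos, fun x hx => ?_⟩
  have hsub : uIcc c x ⊆ ooInterval l r := (ordConnected_ooInterval l r).uIcc_subset hc hx
  have hint : ∫ z in c..x, 2 * b z / σ2 z = ∫ z in c..x, -th z := by
    refine integral_congr fun z hz => ?_
    have hzI := hsub hz
    have hb0 : b z ≠ 0 := left_ne_zero_of_mul (hbth z hzI).ne
    have hth0 : th z ≠ 0 := right_ne_zero_of_mul (hbth z hzI).ne
    simp only [hσ2 z hzI]
    field_simp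
  have hFTC : ∫ z in c..x, th z = (x * th x - κ (th x)) - (c * th c - κ (th c)) := by
    refine integral_eq_sub_of_hasDerivAt (f := fun z => z * th z - κ (th z)) (fun y hy => ?_)
      (hth_cont.mono hsub).intervalIntegrable
    have hyI := hsub hy
    refine hasDerivAt_mul_sub_comp_of_saddlepoint
      ((hth.differentiableOn one_ne_zero).differentiableAt
        ((isOpen_ooInterval l r).mem_nhds hyI)) ?_
    simpa only [hsaddle y hyI] using hκ (th y) (hmap y hyI)
  rw [hm x hx, hint, intervalIntegral.integral_neg, hFTC, mul_right_comm, ← Real.exp_add, mul_comm]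
  ring_nf
end
end

section
/- NIG saddlepoint equation: let α, β, δ, l be real with α > |β| and δ > 0, and let κ(t) = l·t + δ(√(α² − β²) − √(α² − (β+t)²)), defined for |β + t| < α. Define t̂(x) = α(x − l)/√(δ² + (x − l)²) − β for x ∈ ℝ. Then for every x ∈ ℝ one has |β + t̂(x)| < α and κ'(t̂(x)) = x, i.e. t̂ solves the saddlepoint equation for the NIG cumulant-generating function. -/
noncomputable section

/-- NIG saddlepoint equation: for the NIG cumulant-generating function
`κ(t) = lt + δ(√(α²-β²) - √(α²-(β+t)²))` (with `α > |β|`, `δ > 0`), the function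
`t̂(x) = α(x-l)/√(δ²+(x-l)²) - β` satisfies `|β + t̂(x)| < α` and `κ'(t̂(x)) = x`
for every `x ∈ ℝ`. -/
theorem stmt8 (α β δ l : ℝ) (hαβ : |β| < α) (hδ : 0 < δ)
    (κ : ℝ → ℝ)
    (hκ : ∀ t, κ t = l * t +
      δ * (Real.sqrt (α ^ 2 - β ^ 2) - Real.sqrt (α ^ 2 - (β + t) ^ 2)))
    (th : ℝ → ℝ)
    (hth : ∀ x, th x = α * (x - l) / Real.sqrt (δ ^ 2 + (x - l) ^ 2) - β) :
    ∀ x : ℝ, |β + th x| < α ∧ HasDerivAt κ x (th x) := by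
  intro x
  have hα : 0 < α := (abs_nonneg β).trans_lt hαβ
  obtain ⟨s, hs⟩ : ∃ s, s = Real.sqrt (δ ^ 2 + (x - l) ^ 2) := ⟨_, rfl⟩
  have hs0 : 0 < s := hs ▸ Real.sqrt_pos.2 (by positivity)
  have hs2 : s ^ 2 = δ ^ 2 + (x - l) ^ 2 := hs ▸ Real.sq_sqrt (by positivity)
  have hshift : β + th x = α * (x - l) / s := by rw [hth, ← hs]; ring
  have hsq : α ^ 2 - (β + th x) ^ 2 = (α * δ / s) ^ 2 := by
    rw [hshift]
    field_simp
    linear_combination hs2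
  have hpos : 0 < α ^ 2 - (β + th x) ^ 2 := by
    rw [hsq]
    positivity
  refine ⟨abs_lt_of_sq_lt_sq (by linarith) hα.le, ?_⟩
  have hsqrt : Real.sqrt (α ^ 2 - (β + th x) ^ 2) = α * δ / s := by
    rw [hsq, Real.sqrt_sq (by positivity)]
  have hinner : HasDerivAt (fun t => α ^ 2 - (β + t) ^ 2) (-(2 * (β + th x))) (th x) := by
    simpa using (((hasDerivAt_id (th x)).const_add β).pow 2).const_sub (α ^ 2)
  have hderiv := ((hasDerivAt_id (th x)).const_mul l).add
    (((hinner.sqrt hpos.ne').const_sub (Real.sqrt (α ^ 2 - β ^ 2))).const_mul δ)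
  rw [funext hκ]
  refine hderiv.congr_deriv ?_
  rw [hsqrt, hshift]
  field_simp
  ring
end
end

section
/- Positivity of the NIG quasi-saddlepoint diffusion coefficient: let α > |β|, δ > 0, l ∈ ℝ, λ > 0, set t̂(x) = α(x − l)/√(δ² + (x − l)²) − β and μ = l + δβ/√(α² − β²). Then t̂ is strictly increasing on ℝ and t̂(μ) = 0; consequently (x − μ)·t̂(x) > 0 for all x ≠ μ, and the quantity σ²(x) = 2λ √(δ² + (x − l)²) (x − μ) / (α(x − l) − β√(δ² + (x − l)²)) (which equals −2b(x)/t̂(x) for the drift b(x) = −λ(x − μ)) is strictly positive for every x ≠ μ. -/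
noncomputable section

theorem strictMono_div_sqrt_sq_add_sq {δ : ℝ} (hδ : 0 < δ) :
    StrictMono fun u : ℝ => u / Real.sqrt (δ ^ 2 + u ^ 2) := by
  intro u v huv
  have hA : 0 < Real.sqrt (δ ^ 2 + u ^ 2) := Real.sqrt_pos.2 (by positivity)
  have hB : 0 < Real.sqrt (δ ^ 2 + v ^ 2) := Real.sqrt_pos.2 (by positivity)
  have hA2 : Real.sqrt (δ ^ 2 + u ^ 2) ^ 2 = δ ^ 2 + u ^ 2 := Real.sq_sqrt (by positivity)
  have hB2 : Real.sqrt (δ ^ 2 + v ^ 2) ^ 2 = δ ^ 2 + v ^ 2 := Real.sq_sqrt (by positivity)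
  have huA : |u| ≤ Real.sqrt (δ ^ 2 + u ^ 2) := Real.abs_le_sqrt (by nlinarith)
  have hvB : |v| ≤ Real.sqrt (δ ^ 2 + v ^ 2) := Real.abs_le_sqrt (by nlinarith)
  beta_reduce
  rw [div_lt_div_iff₀ hA hB]
  set A := Real.sqrt (δ ^ 2 + u ^ 2)
  set B := Real.sqrt (δ ^ 2 + v ^ 2)
  have huv_le : u * v ≤ A * B := calc
    u * v ≤ |u| * |v| := by rw [← abs_mul]; exact le_abs_self _
    _ ≤ A * B := by gcongr
  have key : (v * A - u * B) * (A + B) = (v - u) * (δ ^ 2 - u * v + A * B) := by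
    linear_combination v * hA2 - u * hB2
  have hpos : 0 < (v * A - u * B) * (A + B) := by
    rw [key]
    have := pow_pos hδ 2
    exact mul_pos (sub_pos.2 huv) (by linarith)
  exact sub_pos.1 (pos_of_mul_pos_left hpos (by positivity))

/-- Positivity of the NIG quasi-saddlepoint diffusion coefficient:
with `t̂(x) = α(x-l)/√(δ²+(x-l)²) - β` and `μ = l + δβ/√(α²-β²)` (`α > |β|`, `δ > 0`,
`λ > 0`), `t̂` is strictly increasing, `t̂(μ) = 0`, `(x-μ) t̂(x) > 0` for `x ≠ μ`, and
`σ²(x) = 2λ√(δ²+(x-l)²)(x-μ)/(α(x-l) - β√(δ²+(x-l)²))`, which equals `-2b(x)/t̂(x)` for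
the drift `b(x) = -λ(x-μ)`, is strictly positive for every `x ≠ μ`. -/
theorem stmt11 (α β δ l lam : ℝ) (hαβ : |β| < α) (hδ : 0 < δ) (hlam : 0 < lam)
    (th : ℝ → ℝ)
    (hth : ∀ x, th x = α * (x - l) / Real.sqrt (δ ^ 2 + (x - l) ^ 2) - β)
    (μ : ℝ) (hμ : μ = l + δ * β / Real.sqrt (α ^ 2 - β ^ 2))
    (b : ℝ → ℝ) (hb : ∀ x, b x = -lam * (x - μ))
    (σ2 : ℝ → ℝ)
    (hσ2 : ∀ x, σ2 x = 2 * lam * Real.sqrt (δ ^ 2 + (x - l) ^ 2) * (x - μ) /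
      (α * (x - l) - β * Real.sqrt (δ ^ 2 + (x - l) ^ 2))) :
    StrictMono th ∧ th μ = 0 ∧
      (∀ x, x ≠ μ → 0 < (x - μ) * th x) ∧
      (∀ x, x ≠ μ → σ2 x = -2 * b x / th x) ∧
      (∀ x, x ≠ μ → 0 < σ2 x) := by
  have hα : 0 < α := (abs_nonneg β).trans_lt hαβ
  have hmono : StrictMono th := by
    intro x y hxy
    have h := mul_lt_mul_of_pos_left
      (strictMono_div_sqrt_sq_add_sq hδ (sub_lt_sub_right hxy l)) hα
    simp only [hth, mul_div_assoc]
    exact sub_lt_sub_right h β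
  have hzero : th μ = 0 := by
    have hgap : 0 < α ^ 2 - β ^ 2 := sub_pos.2 (sq_lt_sq.2 (by rwa [abs_of_pos hα]))
    have hs : 0 < Real.sqrt (α ^ 2 - β ^ 2) := Real.sqrt_pos.2 hgap
    have hs2 : Real.sqrt (α ^ 2 - β ^ 2) ^ 2 = α ^ 2 - β ^ 2 := Real.sq_sqrt hgap.le
    rw [hth, hμ, add_sub_cancel_left]
    set s := Real.sqrt (α ^ 2 - β ^ 2)
    have hroot : Real.sqrt (δ ^ 2 + (δ * β / s) ^ 2) = δ * α / s := by
      rw [Real.sqrt_eq_iff_mul_self_eq (by positivity) (by positivity)]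
      field_simp
      linear_combination hs2
    rw [hroot]
    field_simp
    ring
  have hprod : ∀ x, x ≠ μ → 0 < (x - μ) * th x := by
    intro x hx
    rcases hx.lt_or_gt with h | h
    · exact mul_pos_of_neg_of_neg (sub_neg.2 h) (hzero ▸ hmono h)
    · exact mul_pos (sub_pos.2 h) (hzero ▸ hmono h)
  have hratio : ∀ x, σ2 x = -2 * b x / th x := by
    intro x
    have hR : 0 < Real.sqrt (δ ^ 2 + (x - l) ^ 2) := Real.sqrt_pos.2 (by positivity)
    rw [hσ2, hb, hth, div_sub' hR.ne', div_div_eq_mul_div]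
    congr 1 <;> ring
  refine ⟨hmono, hzero, hprod, fun x _ => hratio x, fun x hx => ?_⟩
  have ht : th x ≠ 0 := right_ne_zero_of_mul (hprod x hx).ne'
  have h : σ2 x = 2 * lam * ((x - μ) * th x) / th x ^ 2 := by
    rw [hratio, hb]
    field_simp
  rw [h]
  have := hprod x hx
  positivity
end
end
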